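/- Suppose the monomial weight x^A is partial, with α_j = 0 exactly for j in a nonempty set J ⊆ {1,…,N}. Then for every function of the form u(x) = a + Σ_{j∈J} a_j x_j + Σ_{j∈J} b_j (x_j² − 1), equality holds in the improved Poincaré inequality: ∫_{ℝ^N_*} |∇u|² dμ_A − ∫_{ℝ^N_*} |u − ∫_{ℝ^N_*} u dμ_A|² dμ_A = (1/2) ∫_{ℝ^N_*} |∇[ u − (∫_{ℝ^N_*} (u − ∫ u dμ_A) x dμ_A) · x ]|² dμ_A, both sides being equal to 2 Σ_{j∈J} b_j²; in particular the improved inequality is attained by non-linear functions. -/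

import Mathlib

open MeasureTheory Real

noncomputable section

/-- The Weyl chamber associated to the monomial weight with exponents `α`. -/
def chamber {N : ℕ} (α : Fin N → ℝ) : Set (EuclideanSpace ℝ (Fin N)) :=
  {x | ∀ i, 0 < α i → 0 < x i}

/-- The monomial weight `x^A = x₁^{α₁} ⋯ x_N^{α_N}`. -/
def monWeight {N : ℕ} (α : Fin N → ℝ) (x : EuclideanSpace ℝ (Fin N)) : ℝ :=
  ∏ i, x i ^ α i

/-- The monomial Gaussian probability measure
`dμ_A = x^A e^{-|x|²/2} dx / ∫_{ℝ^N_*} x^A e^{-|x|²/2} dx` on the Weyl chamber. -/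
def monGauss {N : ℕ} (α : Fin N → ℝ) : Measure (EuclideanSpace ℝ (Fin N)) :=
  (((MeasureTheory.volume.restrict (chamber α)).withDensity
      (fun x => ENNReal.ofReal (monWeight α x * Real.exp (-‖x‖ ^ 2 / 2)))) Set.univ)⁻¹ •
  ((MeasureTheory.volume.restrict (chamber α)).withDensity
      (fun x => ENNReal.ofReal (monWeight α x * Real.exp (-‖x‖ ^ 2 / 2))))

/-- Membership in the class `N_*`: smooth, compactly supported, with vanishing normal
component of the gradient on the boundary of the Weyl chamber. -/
def NstarClass {N : ℕ} (α : Fin N → ℝ) (u : EuclideanSpace ℝ (Fin N) → ℝ) : Prop :=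
  ContDiff ℝ (⊤ : ℕ∞) u ∧ HasCompactSupport u ∧
    ∀ x : EuclideanSpace ℝ (Fin N), ∀ i, 0 < α i → x i = 0 →
      fderiv ℝ u x (EuclideanSpace.single i 1) = 0

end

open ProbabilityTheory

/-- One-dimensional factor of the monomial Gaussian density, extended by zero off the chamber. -/
noncomputable def gaussFactor (a : ℝ) : ℝ → ℝ :=
  Set.indicator {x | 0 < a → 0 < x} (fun x => x ^ a * Real.exp (-x ^ 2 / 2))

/-- One-dimensional unnormalised factor of the monomial Gaussian measure. -/
noncomputable def gaussFactorMeasure (a : ℝ) : Measure ℝ :=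
  volume.withDensity (fun x => ENNReal.ofReal (gaussFactor a x))

/-- One-dimensional marginal of the monomial Gaussian measure. -/
noncomputable def gaussMarginal (a : ℝ) : Measure ℝ :=
  (gaussFactorMeasure a Set.univ)⁻¹ • gaussFactorMeasure a

lemma measurableSet_halfLine (a : ℝ) : MeasurableSet {x : ℝ | 0 < a → 0 < x} := by
  by_cases h : 0 < a
  · simp only [h, forall_const]
    exact measurableSet_Ioi
  · simp [h]

lemma measurable_gaussFactor (a : ℝ) : Measurable (gaussFactor a) :=
  Measurable.indicator (by fun_prop) (measurableSet_halfLine a)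

lemma gaussFactor_nonneg {a : ℝ} (ha : 0 ≤ a) (x : ℝ) : 0 ≤ gaussFactor a x := by
  refine Set.indicator_apply_nonneg fun hx => ?_
  rcases ha.eq_or_lt with rfl | ha
  · simpa using (Real.exp_pos _).le
  · have : 0 < x := hx ha
    positivity

lemma gaussFactor_zero (x : ℝ) : gaussFactor 0 x = Real.exp (-x ^ 2 / 2) := by
  simp [gaussFactor]

lemma integrable_pow_mul_exp_neg_sq (n : ℕ) :
    Integrable (fun x : ℝ => x ^ n * Real.exp (-x ^ 2 / 2)) := by
  have h := integrable_rpow_mul_exp_neg_mul_sq (b := 1 / 2) (by norm_num) (s := n)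
    (by have : (0 : ℝ) ≤ n := n.cast_nonneg
        linarith)
  refine h.congr (.of_forall fun x => ?_)
  simp only [Real.rpow_natCast]
  ring_nf

lemma integrable_pow_mul_gaussFactor {a : ℝ} (ha : 0 ≤ a) (n : ℕ) :
    Integrable (fun x => x ^ n * gaussFactor a x) := by
  rcases ha.eq_or_lt with rfl | ha
  · simpa only [gaussFactor_zero] using integrable_pow_mul_exp_neg_sq n
  have h : IntegrableOn (fun x : ℝ => x ^ n * (x ^ a * Real.exp (-x ^ 2 / 2))) (Set.Ioi 0) := by
    have h0 : (0 : ℝ) ≤ n := n.cast_nonneg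
    refine (integrableOn_rpow_mul_exp_neg_mul_sq (b := 1 / 2) (by norm_num) (s := n + a)
      (by linarith)).congr_fun (fun x hx => ?_) measurableSet_Ioi
    have hx : 0 < x := hx
    simp only [Real.rpow_add hx, Real.rpow_natCast]
    ring_nf
  refine ((integrable_indicator_iff measurableSet_Ioi).2 h).congr (.of_forall fun x => ?_)
  by_cases hx : 0 < x <;> simp [gaussFactor, Set.indicator, ha, hx]

lemma integrable_gaussFactor {a : ℝ} (ha : 0 ≤ a) : Integrable (gaussFactor a) := by
  simpa using integrable_pow_mul_gaussFactor ha 0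

lemma gaussFactorMeasure_univ_ne_top {a : ℝ} (ha : 0 ≤ a) :
    gaussFactorMeasure a Set.univ ≠ ⊤ := by
  rw [gaussFactorMeasure, withDensity_apply _ .univ, setLIntegral_univ,
    ← ofReal_integral_eq_lintegral_ofReal (integrable_gaussFactor ha)
      (.of_forall (gaussFactor_nonneg ha))]
  exact ENNReal.ofReal_ne_top

lemma gaussFactorMeasure_univ_ne_zero (a : ℝ) : gaussFactorMeasure a Set.univ ≠ 0 := by
  rw [gaussFactorMeasure, withDensity_apply _ .univ, setLIntegral_univ]
  intro h
  rw [lintegral_eq_zero_iff (measurable_gaussFactor a).ennreal_ofReal] at h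
  have h2 : (volume : Measure ℝ) (Set.Ioi 0) = 0 := by
    refine measure_mono_null (fun x hx => ?_) (ae_iff.1 h)
    have hx : 0 < x := hx
    have : 0 < x ^ a * Real.exp (-x ^ 2 / 2) := by positivity
    simpa [gaussFactor, hx] using this
  simp at h2

lemma isProbabilityMeasure_gaussMarginal {a : ℝ} (ha : 0 ≤ a) :
    IsProbabilityMeasure (gaussMarginal a) :=
  ⟨ENNReal.inv_mul_cancel (gaussFactorMeasure_univ_ne_zero a)
    (gaussFactorMeasure_univ_ne_top ha)⟩

lemma integrable_pow_gaussMarginal {a : ℝ} (ha : 0 ≤ a) (n : ℕ) :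
    Integrable (fun x => x ^ n) (gaussMarginal a) := by
  refine Integrable.smul_measure ?_ (ENNReal.inv_ne_top.2 (gaussFactorMeasure_univ_ne_zero a))
  rw [gaussFactorMeasure, integrable_withDensity_iff (measurable_gaussFactor a).ennreal_ofReal
    (.of_forall fun _ => ENNReal.ofReal_lt_top)]
  simpa [ENNReal.toReal_ofReal, gaussFactor_nonneg ha] using integrable_pow_mul_gaussFactor ha n

lemma gaussMarginal_zero : gaussMarginal 0 = gaussianReal 0 1 := by
  have h : gaussianReal 0 1 = ENNReal.ofReal (√(2 * π))⁻¹ • gaussFactorMeasure 0 := by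
    rw [gaussianReal_of_var_ne_zero 0 one_ne_zero, gaussFactorMeasure,
      ← withDensity_smul _ (measurable_gaussFactor 0).ennreal_ofReal]
    congr 1
    ext x
    simp [gaussianPDF, gaussianPDFReal, gaussFactor_zero, ENNReal.ofReal_mul]
  have h1 := congrArg (fun m => m Set.univ) h
  simp only [measure_univ, Measure.smul_apply, smul_eq_mul] at h1
  rw [gaussMarginal, h, ENNReal.eq_inv_of_mul_eq_one_left h1.symm]

lemma integral_pow_succ_gaussMarginal_zero (n : ℕ) :
    ∫ x, x ^ (n + 1) ∂gaussMarginal 0 = n * ∫ x, x ^ (n - 1) ∂gaussMarginal 0 := by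
  have key : ∫ x : ℝ, (n * (x ^ (n - 1) * Real.exp (-x ^ 2 / 2)) -
      x ^ (n + 1) * Real.exp (-x ^ 2 / 2)) = 0 := by
    refine integral_eq_zero_of_hasDerivAt_of_integrable
      (f := fun x => x ^ n * Real.exp (-x ^ 2 / 2)) (fun x => ?_)
      (((integrable_pow_mul_exp_neg_sq _).const_mul _).sub (integrable_pow_mul_exp_neg_sq _))
      (integrable_pow_mul_exp_neg_sq n)
    have h := (hasDerivAt_pow n x).mul (((hasDerivAt_pow 2 x).neg.div_const 2).exp)
    refine h.congr_deriv ?_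
    simp
    ring
  rw [integral_sub ((integrable_pow_mul_exp_neg_sq _).const_mul _)
    (integrable_pow_mul_exp_neg_sq _), integral_const_mul, sub_eq_zero] at key
  have h (k : ℕ) : ∫ x, x ^ k ∂gaussMarginal 0 =
      (√(2 * π))⁻¹ * ∫ x, x ^ k * Real.exp (-x ^ 2 / 2) := by
    rw [gaussMarginal_zero, integral_gaussianReal_eq_integral_smul one_ne_zero,
      ← integral_const_mul]
    refine integral_congr_ae (.of_forall fun x => ?_)
    simp [gaussianPDFReal]
    ring
  rw [h, h, ← key]
  ring

lemma integral_poly_gaussMarginal_zero (c₀ c₁ c₂ c₃ c₄ : ℝ) :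
    ∫ x, (c₀ + c₁ * x + c₂ * x ^ 2 + c₃ * x ^ 3 + c₄ * x ^ 4) ∂gaussMarginal 0 =
      c₀ + c₂ + 3 * c₄ := by
  have := isProbabilityMeasure_gaussMarginal le_rfl
  have hi (n : ℕ) (c : ℝ) : Integrable (fun x => c * x ^ n) (gaussMarginal 0) :=
    (integrable_pow_gaussMarginal le_rfl n).const_mul c
  have hi1 : Integrable (fun x => c₁ * x) (gaussMarginal 0) := by simpa using hi 1 c₁
  have m1 := integral_pow_succ_gaussMarginal_zero 0
  have m2 := integral_pow_succ_gaussMarginal_zero 1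
  have m3 := integral_pow_succ_gaussMarginal_zero 2
  have m4 := integral_pow_succ_gaussMarginal_zero 3
  norm_num at m1 m2 m3 m4
  rw [m1] at m3
  rw [m2] at m4
  rw [integral_add (by fun_prop) (hi 4 c₄), integral_add (by fun_prop) (hi 3 c₃),
    integral_add (by fun_prop) (hi 2 c₂), integral_add (by fun_prop) hi1]
  have e1 : ∫ x, c₁ * x ∂gaussMarginal 0 = 0 := by rw [integral_const_mul, m1, mul_zero]
  simp only [integral_const_mul, e1, m2, m3, m4]
  simp
  ring

section Product

variable {N : ℕ} {α : Fin N → ℝ}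

lemma prod_gaussFactor_eq_indicator (α : Fin N → ℝ) (x : EuclideanSpace ℝ (Fin N)) :
    ∏ i, gaussFactor (α i) (x i) =
      (chamber α).indicator (fun x => monWeight α x * Real.exp (-‖x‖ ^ 2 / 2)) x := by
  by_cases hx : x ∈ chamber α
  · rw [Set.indicator_of_mem hx, monWeight, EuclideanSpace.real_norm_sq_eq,
      ← Finset.sum_neg_distrib, Finset.sum_div, Real.exp_sum, ← Finset.prod_mul_distrib]
    exact Finset.prod_congr rfl fun i _ => Set.indicator_of_mem
      (s := {t | 0 < α i → 0 < t}) (hx i) _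
  · rw [Set.indicator_of_notMem hx]
    have hx' : ∃ i, ¬ (0 < α i → 0 < x i) := not_forall.1 hx
    obtain ⟨i, hi⟩ := hx'
    exact Finset.prod_eq_zero (Finset.mem_univ i)
      (Set.indicator_of_notMem (s := {t | 0 < α i → 0 < t}) hi _)

lemma measurableSet_chamber (α : Fin N → ℝ) : MeasurableSet (chamber α) := by
  have : chamber α = ⋂ i, (fun x : EuclideanSpace ℝ (Fin N) => x i) ⁻¹'
      {t | 0 < α i → 0 < t} := by
    ext x
    simp [chamber]
  rw [this]
  exact .iInter fun i => (measurableSet_halfLine (α i)).preimage (by fun_prop)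

lemma withDensity_chamber_eq (α : Fin N → ℝ) :
    (volume.restrict (chamber α)).withDensity
        (fun x => ENNReal.ofReal (monWeight α x * Real.exp (-‖x‖ ^ 2 / 2))) =
      volume.withDensity (fun x : EuclideanSpace ℝ (Fin N) =>
        ENNReal.ofReal (∏ i, gaussFactor (α i) (x i))) := by
  rw [← withDensity_indicator (measurableSet_chamber α)]
  congr 1
  ext x
  rw [prod_gaussFactor_eq_indicator]
  by_cases hx : x ∈ chamber α <;> simp [hx]

/-- The unnormalised monomial Gaussian measure of a box is the product of the factors. -/
lemma withDensity_prod_gaussFactor_pi (hα : ∀ i, 0 ≤ α i) {s : Fin N → Set ℝ}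
    (hs : ∀ i, MeasurableSet (s i)) :
    (volume.withDensity (fun x : EuclideanSpace ℝ (Fin N) =>
        ENNReal.ofReal (∏ i, gaussFactor (α i) (x i))))
        ((WithLp.ofLp : EuclideanSpace ℝ (Fin N) → _) ⁻¹' Set.univ.pi s) =
      ∏ i, gaussFactorMeasure (α i) (s i) := by
  have hbox : MeasurableSet (Set.univ.pi s) := .univ_pi hs
  have hnn (i : Fin N) (t : ℝ) : 0 ≤ (s i).indicator (gaussFactor (α i)) t :=
    Set.indicator_nonneg (fun t _ => gaussFactor_nonneg (hα i) t) t
  have hint (i : Fin N) : Integrable ((s i).indicator (gaussFactor (α i))) :=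
    (integrable_gaussFactor (hα i)).indicator (hs i)
  rw [withDensity_apply _ ((PiLp.volume_preserving_ofLp (Fin N)).measurable hbox),
    (PiLp.volume_preserving_ofLp (Fin N)).setLIntegral_comp_preimage hbox
      (f := fun x => ENNReal.ofReal (∏ i, gaussFactor (α i) (x i)))
      (Finset.measurable_prod _ fun i _ =>
        (measurable_gaussFactor (α i)).comp (measurable_pi_apply i)).ennreal_ofReal,
    ← lintegral_indicator hbox]
  have hind : (Set.univ.pi s).indicator
      (fun x : Fin N → ℝ => ENNReal.ofReal (∏ i, gaussFactor (α i) (x i))) =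
      fun x => ENNReal.ofReal (∏ i, (s i).indicator (gaussFactor (α i)) (x i)) := by
    ext x
    by_cases hx : x ∈ Set.univ.pi s
    · rw [Set.indicator_of_mem hx]
      congr 1
      exact Finset.prod_congr rfl fun i _ => (Set.indicator_of_mem (hx i trivial) _).symm
    · rw [Set.indicator_of_notMem hx]
      have hx' : ∃ i, x i ∉ s i := by simpa [Set.mem_pi] using hx
      obtain ⟨i, hi⟩ := hx'
      rw [Finset.prod_eq_zero (Finset.mem_univ i) (Set.indicator_of_notMem hi _),
        ENNReal.ofReal_zero]
  rw [hind, volume_pi, ← ofReal_integral_eq_lintegral_ofReal (Integrable.fintype_prod hint)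
    (.of_forall fun x => Finset.prod_nonneg fun i _ => hnn i (x i)),
    integral_fintype_prod_eq_prod, ENNReal.ofReal_prod_of_nonneg fun i _ =>
      integral_nonneg (hnn i)]
  refine Finset.prod_congr rfl fun i _ => ?_
  rw [ofReal_integral_eq_lintegral_ofReal (hint i) (.of_forall (hnn i)), gaussFactorMeasure,
    withDensity_apply _ (hs i), ← lintegral_indicator (hs i)]
  congr 1
  ext t
  by_cases ht : t ∈ s i <;> simp [ht]

/-- In coordinates, the monomial Gaussian measure is the product of its marginals. -/
lemma map_ofLp_monGauss (hα : ∀ i, 0 ≤ α i) :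
    (monGauss α).map WithLp.ofLp = Measure.pi fun i => gaussMarginal (α i) := by
  have (i : Fin N) := isProbabilityMeasure_gaussMarginal (hα i)
  refine (Measure.pi_eq fun s hs => ?_).symm
  rw [Measure.map_apply (PiLp.volume_preserving_ofLp (Fin N)).measurable (.univ_pi hs), monGauss,
    withDensity_chamber_eq, Measure.smul_apply, withDensity_prod_gaussFactor_pi hα hs]
  have huniv := withDensity_prod_gaussFactor_pi hα (s := fun _ => Set.univ) fun _ => .univ
  rw [Set.pi_univ, Set.preimage_univ] at huniv
  rw [huniv, smul_eq_mul, ENNReal.prod_inv_distrib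
    fun i _ j _ _ => .inl (gaussFactorMeasure_univ_ne_zero _), ← Finset.prod_mul_distrib]
  rfl

lemma isProbabilityMeasure_monGauss (hα : ∀ i, 0 ≤ α i) :
    IsProbabilityMeasure (monGauss α) := by
  have (i : Fin N) := isProbabilityMeasure_gaussMarginal (hα i)
  have h := map_ofLp_monGauss hα
  refine ⟨?_⟩
  rw [← Set.preimage_univ (f := WithLp.ofLp), ← Measure.map_apply
    (PiLp.volume_preserving_ofLp (Fin N)).measurable .univ, h, measure_univ]

lemma measurePreserving_eval_monGauss (hα : ∀ i, 0 ≤ α i) (i : Fin N) :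
    MeasurePreserving (fun x : EuclideanSpace ℝ (Fin N) => x i) (monGauss α)
      (gaussMarginal (α i)) := by
  have (i : Fin N) := isProbabilityMeasure_gaussMarginal (hα i)
  have h : MeasurePreserving WithLp.ofLp (monGauss α) (Measure.pi fun i => gaussMarginal (α i)) :=
    ⟨(PiLp.volume_preserving_ofLp (Fin N)).measurable, map_ofLp_monGauss hα⟩
  exact (measurePreserving_eval _ i).comp h

lemma iIndepFun_eval_monGauss (hα : ∀ i, 0 ≤ α i) :
    iIndepFun (fun i (x : EuclideanSpace ℝ (Fin N)) => x i) (monGauss α) := by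
  have := isProbabilityMeasure_monGauss hα
  refine (iIndepFun_iff_map_fun_eq_pi_map fun i => by fun_prop).2 ?_
  simp only [(measurePreserving_eval_monGauss hα _).map_eq]
  exact map_ofLp_monGauss hα

lemma integral_comp_eval_monGauss (hα : ∀ i, 0 ≤ α i) (i : Fin N) {f : ℝ → ℝ}
    (hf : Measurable f) :
    ∫ x, f (x i) ∂monGauss α = ∫ t, f t ∂gaussMarginal (α i) := by
  rw [← (measurePreserving_eval_monGauss hα i).map_eq, integral_map
    (measurePreserving_eval_monGauss hα i).aemeasurable hf.aestronglyMeasurable]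

lemma integral_mul_eval_monGauss (hα : ∀ i, 0 ≤ α i) {i j : Fin N} (hij : i ≠ j)
    {f g : ℝ → ℝ} (hf : Measurable f) (hg : Measurable g) :
    ∫ x, f (x i) * g (x j) ∂monGauss α =
      (∫ t, f t ∂gaussMarginal (α i)) * ∫ t, g t ∂gaussMarginal (α j) := by
  rw [← integral_comp_eval_monGauss hα i hf, ← integral_comp_eval_monGauss hα j hg]
  exact (((iIndepFun_eval_monGauss hα).indepFun hij).comp hf hg).integral_fun_mul_eq_mul_integral
    (hf.comp (by fun_prop)).aestronglyMeasurable (hg.comp (by fun_prop)).aestronglyMeasurable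

end Product

/-- The gradient of a sum of functions of one coordinate each. -/
lemma gradient_sum_eval {N : ℕ} (c : ℝ) {f f' : Fin N → ℝ → ℝ}
    (hf : ∀ i t, HasDerivAt (f i) (f' i t) t) (x : EuclideanSpace ℝ (Fin N)) :
    gradient (fun y : EuclideanSpace ℝ (Fin N) => c + ∑ i, f i (y i)) x =
      WithLp.toLp 2 fun i => f' i (x i) := by
  refine HasGradientAt.gradient (hasGradientAt_iff_hasFDerivAt.2 ?_)
  have h : HasFDerivAt (fun y : EuclideanSpace ℝ (Fin N) => c + ∑ i, f i (y i))
      (∑ i, f' i (x i) • (EuclideanSpace.proj i : EuclideanSpace ℝ (Fin N) →L[ℝ] ℝ)) x :=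
    (HasFDerivAt.fun_sum fun i _ => (hf i (x i)).comp_hasFDerivAt x
      (EuclideanSpace.proj i : EuclideanSpace ℝ (Fin N) →L[ℝ] ℝ).hasFDerivAt).const_add c
  refine h.congr_fderiv ?_
  ext y
  simp [PiLp.inner_apply, mul_comm]

lemma memLp_two_quadratic_monGauss {N : ℕ} {α : Fin N → ℝ} (hα : ∀ i, 0 ≤ α i) (i : Fin N)
    (p q r : ℝ) : MemLp (fun x : EuclideanSpace ℝ (Fin N) => p + q * x i + r * x i ^ 2) 2
      (monGauss α) := by
  have := isProbabilityMeasure_gaussMarginal (hα i)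
  have hpow (n : ℕ) (c : ℝ) : Integrable (fun t => c * t ^ n) (gaussMarginal (α i)) :=
    (integrable_pow_gaussMarginal (hα i) n).const_mul c
  have h : MemLp (fun t : ℝ => p + q * t + r * t ^ 2) 2 (gaussMarginal (α i)) := by
    refine (memLp_two_iff_integrable_sq (by fun_prop)).2 ?_
    refine ((((hpow 0 (p ^ 2)).add (hpow 1 (2 * p * q))).add
      (hpow 2 (q ^ 2 + 2 * p * r))).add (hpow 3 (2 * q * r))).add (hpow 4 (r ^ 2)) |>.congr
      (.of_forall fun t => ?_)
    simp only [Pi.add_apply]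
    ring
  exact h.comp_measurePreserving (measurePreserving_eval_monGauss hα i)

/-- A polynomial of degree at most four in a coordinate with trivial exponent has its Gaussian
expectation. -/
lemma integral_quartic_monGauss {N : ℕ} {α : Fin N → ℝ} (hα : ∀ i, 0 ≤ α i) {i : Fin N}
    (hi : α i = 0) (c₀ c₁ c₂ c₃ c₄ : ℝ) :
    ∫ x, (c₀ + c₁ * x i + c₂ * x i ^ 2 + c₃ * x i ^ 3 + c₄ * x i ^ 4) ∂monGauss α =
      c₀ + c₂ + 3 * c₄ := by
  rw [integral_comp_eval_monGauss hα i
    (f := fun t => c₀ + c₁ * t + c₂ * t ^ 2 + c₃ * t ^ 3 + c₄ * t ^ 4) (by fun_prop), hi,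
    integral_poly_gaussMarginal_zero]

section Quadratic

variable {N : ℕ} {α : Fin N → ℝ} {p q : Fin N → ℝ}

/-- Moments of the one-coordinate functions `p x + q (x² - 1)`, with `p` and `q` vanishing unless
the exponent of the coordinate is zero. -/
lemma integral_hermite_monGauss (hα : ∀ i, 0 ≤ α i) (hp : ∀ j, α j ≠ 0 → p j = 0)
    (hq : ∀ j, α j ≠ 0 → q j = 0) (i : Fin N) :
    ∫ x, (p i * x i + q i * (x i ^ 2 - 1)) ∂monGauss α = 0 := by
  by_cases hi : α i = 0
  · have h := integral_quartic_monGauss hα hi (-q i) (p i) (q i) 0 0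
    rw [show -q i + q i + 3 * 0 = 0 by ring] at h
    rw [← h]
    congr 1
    ext x
    ring
  · simp [hp i hi, hq i hi]

lemma memLp_hermite_monGauss (hα : ∀ i, 0 ≤ α i) (p q : ℝ) (i : Fin N) :
    MemLp (fun x : EuclideanSpace ℝ (Fin N) => p * x i + q * (x i ^ 2 - 1)) 2 (monGauss α) := by
  convert memLp_two_quadratic_monGauss hα i (-q) p q using 2
  ring

lemma integral_hermite_mul_hermite_monGauss (hα : ∀ i, 0 ≤ α i) (hp : ∀ j, α j ≠ 0 → p j = 0)
    (hq : ∀ j, α j ≠ 0 → q j = 0) (i j : Fin N) :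
    ∫ x, (p i * x i + q i * (x i ^ 2 - 1)) * (p j * x j + q j * (x j ^ 2 - 1)) ∂monGauss α =
      if i = j then p i ^ 2 + 2 * q i ^ 2 else 0 := by
  split_ifs with hij
  · subst hij
    by_cases hi : α i = 0
    · have h := integral_quartic_monGauss hα hi (q i ^ 2) (-2 * p i * q i)
        (p i ^ 2 - 2 * q i ^ 2) (2 * p i * q i) (q i ^ 2)
      rw [show q i ^ 2 + (p i ^ 2 - 2 * q i ^ 2) + 3 * q i ^ 2 = p i ^ 2 + 2 * q i ^ 2 by ring] at h
      rw [← h]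
      congr 1
      ext x
      ring
    · simp [hp i hi, hq i hi]
  · rw [integral_mul_eval_monGauss hα hij (f := fun t => p i * t + q i * (t ^ 2 - 1))
      (g := fun t => p j * t + q j * (t ^ 2 - 1)) (by fun_prop) (by fun_prop),
      ← integral_comp_eval_monGauss hα i (by fun_prop), integral_hermite_monGauss hα hp hq,
      zero_mul]

lemma integral_hermite_mul_eval_monGauss (hα : ∀ i, 0 ≤ α i) (hp : ∀ j, α j ≠ 0 → p j = 0)
    (hq : ∀ j, α j ≠ 0 → q j = 0) (i j : Fin N) :
    ∫ x, (p i * x i + q i * (x i ^ 2 - 1)) * x j ∂monGauss α = if i = j then p i else 0 := by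
  split_ifs with hij
  · subst hij
    by_cases hi : α i = 0
    · have h := integral_quartic_monGauss hα hi 0 (-q i) (p i) (q i) 0
      rw [show 0 + p i + 3 * 0 = p i by ring] at h
      refine Eq.trans ?_ h
      congr 1
      ext x
      ring
    · simp [hp i hi, hq i hi]
  · rw [integral_mul_eval_monGauss hα hij (f := fun t => p i * t + q i * (t ^ 2 - 1))
      (g := fun t => t) (by fun_prop) (by fun_prop),
      ← integral_comp_eval_monGauss hα i (by fun_prop), integral_hermite_monGauss hα hp hq,
      zero_mul]

lemma integral_sum_hermite_monGauss (hα : ∀ i, 0 ≤ α i) (hp : ∀ j, α j ≠ 0 → p j = 0)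
    (hq : ∀ j, α j ≠ 0 → q j = 0) :
    ∫ x, ∑ i, (p i * x i + q i * (x i ^ 2 - 1)) ∂monGauss α = 0 := by
  have := isProbabilityMeasure_monGauss hα
  rw [integral_finsetSum _ fun i _ =>
    (memLp_hermite_monGauss hα (p i) (q i) i).integrable (by norm_num)]
  simp [integral_hermite_monGauss hα hp hq]

lemma integral_sum_hermite_sq_monGauss (hα : ∀ i, 0 ≤ α i) (hp : ∀ j, α j ≠ 0 → p j = 0)
    (hq : ∀ j, α j ≠ 0 → q j = 0) :
    ∫ x, (∑ i, (p i * x i + q i * (x i ^ 2 - 1))) ^ 2 ∂monGauss α =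
      ∑ i, (p i ^ 2 + 2 * q i ^ 2) := by
  have hint (i j : Fin N) : Integrable (fun x : EuclideanSpace ℝ (Fin N) =>
      (p i * x i + q i * (x i ^ 2 - 1)) * (p j * x j + q j * (x j ^ 2 - 1))) (monGauss α) :=
    (memLp_hermite_monGauss hα (p i) (q i) i).integrable_mul
      (memLp_hermite_monGauss hα (p j) (q j) j)
  simp_rw [sq (∑ i, _), Finset.sum_mul_sum]
  rw [integral_finsetSum _ fun i _ => integrable_finsetSum _ fun j _ => hint i j]
  refine Finset.sum_congr rfl fun i _ => ?_
  rw [integral_finsetSum _ fun j _ => hint i j]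
  simp [integral_hermite_mul_hermite_monGauss hα hp hq]

lemma integral_sum_hermite_mul_eval_monGauss (hα : ∀ i, 0 ≤ α i) (hp : ∀ j, α j ≠ 0 → p j = 0)
    (hq : ∀ j, α j ≠ 0 → q j = 0) (j : Fin N) :
    ∫ x, (∑ i, (p i * x i + q i * (x i ^ 2 - 1))) * x j ∂monGauss α = p j := by
  have hint (i : Fin N) : Integrable (fun x : EuclideanSpace ℝ (Fin N) =>
      (p i * x i + q i * (x i ^ 2 - 1)) * x j) (monGauss α) := by
    have h := memLp_hermite_monGauss hα 1 0 j
    simp only [one_mul, zero_mul, add_zero] at h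
    exact (memLp_hermite_monGauss hα (p i) (q i) i).integrable_mul h
  simp_rw [Finset.sum_mul]
  rw [integral_finsetSum _ fun i _ => hint i]
  simp [integral_hermite_mul_eval_monGauss hα hp hq]

/-- The Dirichlet energy of `c + Σ (p_j x_j + q_j (x_j² - 1))`. -/
lemma integral_norm_gradient_sq_monGauss (hα : ∀ i, 0 ≤ α i) (hp : ∀ j, α j ≠ 0 → p j = 0)
    (hq : ∀ j, α j ≠ 0 → q j = 0) (c : ℝ) :
    ∫ x, ‖gradient (fun y : EuclideanSpace ℝ (Fin N) =>
      c + ∑ i, (p i * y i + q i * (y i ^ 2 - 1))) x‖ ^ 2 ∂monGauss α =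
      ∑ i, (p i ^ 2 + 4 * q i ^ 2) := by
  have hderiv (i : Fin N) (t : ℝ) :
      HasDerivAt (fun t => p i * t + q i * (t ^ 2 - 1)) (p i + 2 * q i * t) t := by
    refine (((hasDerivAt_id t).const_mul (p i)).add
      (((hasDerivAt_pow 2 t).sub_const 1).const_mul (q i))).congr_deriv ?_
    simp
    ring
  simp_rw [gradient_sum_eval c (f := fun i t => p i * t + q i * (t ^ 2 - 1)) hderiv,
    EuclideanSpace.real_norm_sq_eq]
  have hint (i : Fin N) : Integrable
      (fun x : EuclideanSpace ℝ (Fin N) => (p i + 2 * q i * x i) ^ 2) (monGauss α) := by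
    refine MemLp.integrable_sq ?_
    simpa using memLp_two_quadratic_monGauss hα i (p i) (2 * q i) 0
  rw [integral_finsetSum _ fun i _ => hint i]
  refine Finset.sum_congr rfl fun i _ => ?_
  by_cases hi : α i = 0
  · have h := integral_quartic_monGauss hα hi (p i ^ 2) (4 * p i * q i) (4 * q i ^ 2) 0 0
    rw [show p i ^ 2 + 4 * q i ^ 2 + 3 * 0 = p i ^ 2 + 4 * q i ^ 2 by ring] at h
    rw [← h]
    congr 1
    ext x
    ring
  · simp [hp i hi, hq i hi]

end Quadratic


/-- If the monomial weight is partial (with `α_j = 0` exactly for `j ∈ J`), equality holds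
in the improved Poincaré inequality for `u(x) = a + Σ_{j∈J} a_j x_j + Σ_{j∈J} b_j (x_j²−1)`,
both sides being `2 Σ_{j∈J} b_j²`; in particular the improved inequality is attained by
non-linear functions. -/
theorem improved_poincare_monomial_gaussian_attained {N : ℕ} (hN : 1 ≤ N) (α : Fin N → ℝ)
    (hα : ∀ i, 0 ≤ α i) (hpartial : ∃ i, α i = 0) (a : ℝ) (aj bj : Fin N → ℝ)
    (hsuppa : ∀ j, α j ≠ 0 → aj j = 0) (hsuppb : ∀ j, α j ≠ 0 → bj j = 0) :
    let u : EuclideanSpace ℝ (Fin N) → ℝ :=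
      fun x => a + (∑ j, aj j * x j) + ∑ j, bj j * ((x j) ^ 2 - 1)
    let μ := monGauss α
    let m := ∫ y, u y ∂μ
    let v : Fin N → ℝ := fun j => ∫ z, (u z - m) * z j ∂μ
    (∫ x, ‖gradient u x‖ ^ 2 ∂μ) - (∫ x, (u x - m) ^ 2 ∂μ) =
      (1 / 2) * (∫ x, ‖gradient (fun y => u y - ∑ j, v j * y j) x‖ ^ 2 ∂μ) ∧
    (∫ x, ‖gradient u x‖ ^ 2 ∂μ) - (∫ x, (u x - m) ^ 2 ∂μ) = 2 * ∑ j, (bj j) ^ 2 := by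
  intro u μ m v
  have := isProbabilityMeasure_monGauss hα
  have hu : u = fun x => a + ∑ j, (aj j * x j + bj j * (x j ^ 2 - 1)) := by
    ext x
    simp only [u, Finset.sum_add_distrib, add_assoc]
  have hm : m = a := by
    simp only [m, μ, hu]
    rw [integral_add (integrable_const _) (integrable_finsetSum _ fun i _ =>
      (memLp_hermite_monGauss hα (aj i) (bj i) i).integrable (by norm_num)),
      integral_sum_hermite_monGauss hα hsuppa hsuppb]
    simp
  have hv : v = aj := by
    ext j
    simp only [v, μ, hm, hu, add_sub_cancel_left]
    exact integral_sum_hermite_mul_eval_monGauss hα hsuppa hsuppb j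
  have hw : (fun y => u y - ∑ j, v j * y j) =
      fun y : EuclideanSpace ℝ (Fin N) =>
        a + ∑ j, ((0 : Fin N → ℝ) j * y j + bj j * (y j ^ 2 - 1)) := by
    ext y
    simp only [hv, u, Pi.zero_apply, zero_mul, zero_add]
    ring
  rw [hw]
  simp only [hm, hu, add_sub_cancel_left]
  rw [integral_norm_gradient_sq_monGauss hα hsuppa hsuppb,
    integral_norm_gradient_sq_monGauss (p := 0) hα (fun _ _ => rfl) hsuppb,
    integral_sum_hermite_sq_monGauss hα hsuppa hsuppb]
  simp only [Finset.sum_add_distrib, ← Finset.mul_sum]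
  constructor
  · simp
    ring
  · ring
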